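/- Suppose λ = 0 (F is a bounded Hölder function) and φ̄ := Σ_{n=0}^∞ φ(n) < ∞. Then there exists a constant B > 0, depending only on ℓ, such that for every N ≥ 1 and r ≥ 0 there is a martingale (M^{(N,r)}_n)_{n≥1} with respect to the filtration (𝓕_{−∞, n+r})_{n≥1} whose differences satisfy ‖M^{(N,r)}_{n+1} − M^{(N,r)}_n‖_∞ ≤ B K (φ̄ + r + 1) for all n, and ‖ S_N − M^{(N,r)}_{ℓN} ‖_{L^∞} ≤ B K N (β_∞(r))^κ + B K (φ̄ + r + 1). -/

import Mathlib

open MeasureTheory ProbabilityTheory Filter Finset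
open scoped ENNReal

noncomputable section

/-- The `φ`-dependence coefficient between two sub-σ-algebras. -/
def phiDep {Ω : Type*} [MeasurableSpace Ω] (P : Measure Ω)
    (G H : MeasurableSpace Ω) : ℝ :=
  sSup {x | ∃ A B : Set Ω, MeasurableSet[G] A ∧ MeasurableSet[H] B ∧ 0 < P A ∧
    x = |(P (A ∩ B)).toReal / (P A).toReal - (P B).toReal|}

/-- The mixing coefficient `φ(n)` associated with the family `𝓕_{k,l}`. -/
def phiCoef {Ω : Type*} [MeasurableSpace Ω]
    (𝓕 : WithBot ℤ → WithTop ℤ → MeasurableSpace Ω) (P : Measure Ω) (n : ℕ) : ℝ :=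
  ⨆ k : ℤ, phiDep P (𝓕 ⊥ (k : WithTop ℤ)) (𝓕 ((k + n : ℤ) : WithBot ℤ) ⊤)

/-- The approximation coefficient `β_q(r)`. -/
def betaCoef {Ω : Type*} [MeasurableSpace Ω] {E : Type*} [NormedAddCommGroup E]
    [NormedSpace ℝ E] [CompleteSpace E] [MeasurableSpace E]
    (ξ : ℕ → Ω → E) (𝓕 : WithBot ℤ → WithTop ℤ → MeasurableSpace Ω) (P : Measure Ω)
    (q : ℝ≥0∞) (r : ℕ) : ℝ≥0∞ :=
  ⨆ k : ℕ, eLpNorm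
    (fun ω => ξ k ω - (P[ξ k | 𝓕 (((k : ℤ) - r : ℤ) : WithBot ℤ) (((k : ℤ) + r : ℤ) : WithTop ℤ)]) ω)
    q P

/-- The nonconventional sum `S_N = ∑_{n=1}^N F(ξ_n, ξ_{2n}, …, ξ_{ℓn})`. -/
def noncSum {Ω : Type*} {E : Type*} (ℓ : ℕ) (ξ : ℕ → Ω → E)
    (F : (Fin ℓ → E) → ℝ) (N : ℕ) (ω : Ω) : ℝ :=
  ∑ n ∈ Finset.Icc 1 N, F (fun i => ξ ((i.1 + 1) * n) ω)

/-- The `k`-th cumulant `Γ_k(W) = i^{-k} (d^k/dt^k) ln E e^{itW} |_{t=0}`. -/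
def cumulant {Ω : Type*} [MeasurableSpace Ω] (P : Measure Ω) (W : Ω → ℝ) (k : ℕ) : ℂ :=
  Complex.I ^ (-(k : ℤ)) *
    iteratedDeriv k (fun t : ℝ => Complex.log (∫ ω, Complex.exp (Complex.I * t * W ω) ∂P)) 0


/-- If every `B ∈ H` satisfies `|P(A ∩ B) - P(A) P(B)| ≤ c`, then `∫_A g - P(A) ∫ g` is at most
`2Kc` for every `H`-measurable `g` bounded by `K`. -/
lemma abs_setIntegral_sub_mul_integral_le {Ω : Type*} {H : MeasurableSpace Ω}
    {mΩ : MeasurableSpace Ω} {P : Measure Ω}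
    [IsProbabilityMeasure P] (hH : H ≤ mΩ) {A : Set Ω} {c K : ℝ}
    (hK : 0 ≤ K)
    (hc : ∀ B, MeasurableSet[H] B → |P.real (A ∩ B) - P.real A * P.real B| ≤ c)
    {g : Ω → ℝ} (hg : StronglyMeasurable[H] g) (hgK : ∀ ω, |g ω| ≤ K) :
    |∫ ω in A, g ω ∂P - P.real A * ∫ ω, g ω ∂P| ≤ 2 * K * c := by
  have hgi : Integrable g P :=
    .of_bound (hg.mono hH).aestronglyMeasurable K (ae_of_all _ hgK)
  have hfi : Integrable (fun ω => g ω + K) P := hgi.add (integrable_const K)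
  have hf0 : ∀ ω, 0 ≤ g ω + K := fun ω => by linarith [neg_le_of_abs_le (hgK ω)]
  have hf1 : ∀ ω, g ω + K ≤ 2 * K := fun ω => by linarith [le_of_abs_le (hgK ω)]
  have hanti : ∀ μ : Measure Ω, IsFiniteMeasure μ →
      IntegrableOn (fun t => μ.real {ω | t ≤ g ω + K}) (Set.Ioc 0 (2 * K)) volume := by
    intro μ _
    have : Antitone fun t : ℝ => μ.real {ω | t ≤ g ω + K} := fun s t hst =>
      measureReal_mono fun ω (hω : t ≤ g ω + K) => hst.trans hω
    exact (this.locallyIntegrable.integrableOn_isCompact isCompact_Icc).mono_set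
      Set.Ioc_subset_Icc_self
  have hshift : ∫ ω in A, g ω ∂P - P.real A * ∫ ω, g ω ∂P
      = ∫ ω in A, (g ω + K) ∂P - P.real A * ∫ ω, (g ω + K) ∂P := by
    rw [integral_add hgi (integrable_const K),
      integral_add hgi.integrableOn (integrable_const K)]
    simp
    ring
  rw [hshift, Integrable.integral_eq_integral_Ioc_meas_le hfi (ae_of_all _ hf0) (ae_of_all _ hf1),
    Integrable.integral_eq_integral_Ioc_meas_le hfi.integrableOn (ae_of_all _ hf0)
      (ae_of_all _ hf1), ← integral_const_mul,
    ← integral_sub (hanti _ inferInstance) ((hanti _ inferInstance).const_mul _)]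
  have := norm_setIntegral_le_of_norm_le_const (μ := volume) (s := Set.Ioc 0 (2 * K)) (C := c)
    (f := fun t => (P.restrict A).real {ω | t ≤ g ω + K} - P.real A * P.real {ω | t ≤ g ω + K})
    measure_Ioc_lt_top (fun t _ => by
      have hB : MeasurableSet[H] {ω | t ≤ g ω + K} :=
        measurableSet_le measurable_const (hg.measurable.add_const K)
      rw [measureReal_restrict_apply (hH _ hB), Set.inter_comm, Real.norm_eq_abs]
      exact hc _ hB)
  rw [Real.norm_eq_abs] at this
  refine this.trans (le_of_eq ?_)
  simp [hK]
  ring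

lemma continuous_integral_comp {Ω V W : Type*} {mΩ : MeasurableSpace Ω} {P : Measure Ω}
    [IsFiniteMeasure P] [TopologicalSpace V] [FirstCountableTopology V] [TopologicalSpace W]
    {h : V → W → ℝ} (hh : Continuous (Function.uncurry h)) {K : ℝ} (hhK : ∀ x y, |h x y| ≤ K)
    {Y : Ω → W} (hY : StronglyMeasurable Y) :
    Continuous fun x => ∫ ω, h x (Y ω) ∂P := by
  refine continuous_of_dominated (bound := fun _ => K) (fun x => ?_)
    (fun x => ae_of_all _ fun ω => hhK _ _) (integrable_const K) (ae_of_all _ fun ω => ?_)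
  · exact ((hh.comp (.prodMk_right x)).comp_stronglyMeasurable hY).aestronglyMeasurable
  · exact hh.comp (.prodMk_left (Y ω))

/-- Decoupling under `φ`-mixing: on sets of `G`, a bounded function of a `G`-measurable `X` and an
`H`-measurable `Y` may be averaged over an independent copy of `Y`. -/
lemma abs_setIntegral_sub_integral_comp_le {Ω V W : Type*} {G H : MeasurableSpace Ω}
    {mΩ : MeasurableSpace Ω}
    {P : Measure Ω} [IsProbabilityMeasure P] [TopologicalSpace V] [FirstCountableTopology V]
    [TopologicalSpace W] (hG : G ≤ mΩ) (hH : H ≤ mΩ) {c K : ℝ}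
    (hK : 0 ≤ K)
    (hc : ∀ A B, MeasurableSet[G] A → MeasurableSet[H] B →
      |P.real (A ∩ B) - P.real A * P.real B| ≤ c * P.real A)
    {h : V → W → ℝ} (hh : Continuous (Function.uncurry h)) (hhK : ∀ x y, |h x y| ≤ K)
    {X : Ω → V} {Y : Ω → W} (hX : StronglyMeasurable[G] X) (hY : StronglyMeasurable[H] Y)
    {A : Set Ω} (hA : MeasurableSet[G] A) :
    |∫ ω in A, (h (X ω) (Y ω) - ∫ ω', h (X ω) (Y ω') ∂P) ∂P| ≤ 2 * K * c * P.real A := by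
  have hcont := continuous_integral_comp (P := P) hh hhK (hY.mono hH)
  have hbound : ∀ x y, ‖h x y - ∫ ω', h x (Y ω') ∂P‖ ≤ K + K := fun x y => by
    refine (norm_sub_le _ _).trans (add_le_add (hhK x y) ?_)
    simpa using norm_integral_le_of_norm_le_const (μ := P) (f := fun ω' => h x (Y ω'))
      (ae_of_all P fun ω' => hhK x (Y ω'))
  have hmeas : ∀ Z : Ω → V, StronglyMeasurable Z →
      StronglyMeasurable fun ω => h (Z ω) (Y ω) - ∫ ω', h (Z ω) (Y ω') ∂P := fun Z hZ =>
    (hh.comp_stronglyMeasurable (hZ.prodMk (hY.mono hH))).sub (hcont.comp_stronglyMeasurable hZ)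
  have hsimple : ∀ s : @SimpleFunc Ω G V,
      |∫ ω in A, (h (s ω) (Y ω) - ∫ ω', h (s ω) (Y ω') ∂P) ∂P| ≤ 2 * K * c * P.real A := by
    intro s
    have hs : StronglyMeasurable (s : Ω → V) := (@SimpleFunc.stronglyMeasurable _ _ G _ s).mono hG
    have hpm : ∀ x, MeasurableSet[G] (A ∩ s ⁻¹' {x}) := fun x =>
      hA.inter (@SimpleFunc.measurableSet_fiber _ _ G s x)
    have hdisj : Set.Pairwise (↑(@SimpleFunc.range _ _ G s))
        (Function.onFun Disjoint fun x => A ∩ s ⁻¹' {x}) := fun x _ y _ hxy =>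
      Set.disjoint_left.2 fun ω h1 h2 => hxy (h1.2.symm.trans h2.2)
    have hunion : A = ⋃ x ∈ @SimpleFunc.range _ _ G s, A ∩ s ⁻¹' {x} := by
      ext ω
      simp
    have hPA : P.real A = ∑ x ∈ @SimpleFunc.range _ _ G s, P.real (A ∩ s ⁻¹' {x}) := by
      conv_lhs => rw [hunion]
      exact measureReal_biUnion_finset hdisj fun x _ => hG _ (hpm x)
    have hint : ∫ ω in A, (h (s ω) (Y ω) - ∫ ω', h (s ω) (Y ω') ∂P) ∂P
        = ∑ x ∈ @SimpleFunc.range _ _ G s,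
          ∫ ω in A ∩ s ⁻¹' {x}, (h (s ω) (Y ω) - ∫ ω', h (s ω) (Y ω') ∂P) ∂P := by
      conv_lhs => rw [hunion]
      refine integral_biUnion_finset _ (fun x _ => hG _ (hpm x)) hdisj fun x _ => ?_
      exact (Integrable.of_bound (hmeas _ hs).aestronglyMeasurable (K + K)
        (ae_of_all _ fun ω => hbound _ _)).integrableOn
    rw [hint, hPA, Finset.mul_sum]
    refine (Finset.abs_sum_le_sum_abs _ _).trans (Finset.sum_le_sum fun x _ => ?_)
    have hfix : ∫ ω in A ∩ s ⁻¹' {x}, (h (s ω) (Y ω) - ∫ ω', h (s ω) (Y ω') ∂P) ∂P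
        = ∫ ω in A ∩ s ⁻¹' {x}, h x (Y ω) ∂P
          - P.real (A ∩ s ⁻¹' {x}) * ∫ ω, h x (Y ω) ∂P := by
      have hxi : Integrable (fun ω => h x (Y ω)) P :=
        .of_bound ((hh.comp (.prodMk_right x)).comp_stronglyMeasurable
          (hY.mono hH)).aestronglyMeasurable K (ae_of_all _ fun ω => hhK _ _)
      rw [setIntegral_congr_fun (g := fun ω => h x (Y ω) - ∫ ω', h x (Y ω') ∂P) (hG _ (hpm x))
        (fun ω hω => by
          have : s ω = x := hω.2
          simp only [this]),
        integral_sub hxi.integrableOn (integrable_const _)]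
      simp
    rw [hfix]
    refine (abs_setIntegral_sub_mul_integral_le hH hK
      (fun B hB => hc _ B (hpm x) hB)
      ((hh.comp (.prodMk_right x)).comp_stronglyMeasurable hY) fun ω => hhK _ _).trans
      (le_of_eq (by ring))
  have hlim : Tendsto
      (fun n => ∫ ω in A, (h (hX.approx n ω) (Y ω) - ∫ ω', h (hX.approx n ω) (Y ω') ∂P) ∂P) atTop
      (nhds (∫ ω in A, (h (X ω) (Y ω) - ∫ ω', h (X ω) (Y ω') ∂P) ∂P)) := by
    refine tendsto_integral_of_dominated_convergence (fun _ => K + K) (fun n => ?_)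
      (integrable_const _) (fun n => ae_of_all _ fun ω => hbound _ _) (ae_of_all _ fun ω => ?_)
    · exact (hmeas _ ((@SimpleFunc.stronglyMeasurable _ _ G _ _).mono hG)).aestronglyMeasurable
    · exact ((hh.comp (.prodMk_left (Y ω))).sub hcont).continuousAt.tendsto.comp
        (hX.tendsto_approx ω)
  exact le_of_tendsto hlim.abs (Eventually.of_forall fun n => hsimple _)

lemma condExp_le_of_forall_setIntegral_le {Ω : Type*} {G : MeasurableSpace Ω}
    {mΩ : MeasurableSpace Ω} {P : Measure Ω}
    [IsFiniteMeasure P] (hG : G ≤ mΩ) {f : Ω → ℝ} (hf : Integrable f P)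
    {c : ℝ} (hc : ∀ A, MeasurableSet[G] A → ∫ ω in A, f ω ∂P ≤ c * P.real A) :
    ∀ᵐ ω ∂P, (P[f | G]) ω ≤ c := by
  refine ae_le_of_ae_le_trim (hm := hG) (f₂ := fun _ => c)
    (ae_le_of_forall_setIntegral_le (integrable_condExp.trim hG stronglyMeasurable_condExp)
      (integrable_const c) fun A hA _ => ?_)
  rw [← setIntegral_trim hG stronglyMeasurable_condExp hA, setIntegral_condExp hG hf hA,
    ← setIntegral_trim hG stronglyMeasurable_const hA]
  simpa [mul_comm] using hc A hA

lemma abs_condExp_le_of_forall_abs_setIntegral_le {Ω : Type*} {G : MeasurableSpace Ω}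
    {mΩ : MeasurableSpace Ω}
    {P : Measure Ω} [IsFiniteMeasure P] (hG : G ≤ mΩ) {f : Ω → ℝ}
    (hf : Integrable f P) {c : ℝ}
    (hc : ∀ A, MeasurableSet[G] A → |∫ ω in A, f ω ∂P| ≤ c * P.real A) :
    ∀ᵐ ω ∂P, |(P[f | G]) ω| ≤ c := by
  filter_upwards [condExp_le_of_forall_setIntegral_le hG hf fun A hA => (abs_le.1 (hc A hA)).2,
    condExp_le_of_forall_setIntegral_le hG hf.neg (c := c) fun A hA => by
      simpa [integral_neg] using neg_le.1 (abs_le.1 (hc A hA)).1,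
    condExp_neg f G (μ := P)] with ω h1 h2 h3
  rw [h3, Pi.neg_apply] at h2
  exact abs_le.2 ⟨by linarith, h1⟩

/-- Enlarging the conditioning from `G'` to `G` hardly changes the conditional expectation of a
function of a `G'`-measurable variable and of a variable nearly independent of `G`. -/
lemma abs_condExp_sub_condExp_le {Ω V W : Type*} {G' G H : MeasurableSpace Ω}
    {mΩ : MeasurableSpace Ω}
    {P : Measure Ω} [IsProbabilityMeasure P] [TopologicalSpace V] [FirstCountableTopology V]
    [TopologicalSpace W] (hG' : G' ≤ G) (hG : G ≤ mΩ) (hH : H ≤ mΩ)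
    {c K : ℝ} (hK : 0 ≤ K)
    (hc : ∀ A B, MeasurableSet[G] A → MeasurableSet[H] B →
      |P.real (A ∩ B) - P.real A * P.real B| ≤ c * P.real A)
    {h : V → W → ℝ} (hh : Continuous (Function.uncurry h)) (hhK : ∀ x y, |h x y| ≤ K)
    {X : Ω → V} {Y : Ω → W} (hX : StronglyMeasurable[G'] X) (hY : StronglyMeasurable[H] Y) :
    ∀ᵐ ω ∂P, |(P[fun ω => h (X ω) (Y ω) | G]) ω - (P[fun ω => h (X ω) (Y ω) | G']) ω|
      ≤ 4 * K * c := by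
  set Z : Ω → ℝ := fun ω => h (X ω) (Y ω)
  set U : Ω → ℝ := fun ω => ∫ ω', h (X ω) (Y ω') ∂P
  have hZ : Integrable Z P := .of_bound (hh.comp_stronglyMeasurable
    ((hX.mono (hG'.trans hG)).prodMk (hY.mono hH))).aestronglyMeasurable K
    (ae_of_all _ fun ω => hhK _ _)
  have hUm : StronglyMeasurable[G'] U :=
    (continuous_integral_comp (P := P) hh hhK (hY.mono hH)).comp_stronglyMeasurable hX
  have hU : Integrable U P := .of_bound (hUm.mono (hG'.trans hG)).aestronglyMeasurable K
    (ae_of_all _ fun ω => by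
      simpa using norm_integral_le_of_norm_le_const (μ := P) (f := fun ω' => h (X ω) (Y ω'))
        (ae_of_all P fun ω' => hhK _ (Y ω')))
  have hset : ∀ A, MeasurableSet[G] A → |∫ ω in A, (Z - U) ω ∂P| ≤ 2 * K * c * P.real A :=
    fun A hA => abs_setIntegral_sub_integral_comp_le hG hH hK hc hh hhK (hX.mono hG') hY hA
  filter_upwards [abs_condExp_le_of_forall_abs_setIntegral_le hG (hZ.sub hU) hset,
    abs_condExp_le_of_forall_abs_setIntegral_le (hG'.trans hG) (hZ.sub hU)
      fun A hA => hset A (hG' _ hA),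
    condExp_sub hZ hU G, condExp_sub hZ hU G'] with ω h1 h2 h3 h4
  rw [h3, Pi.sub_apply, condExp_of_stronglyMeasurable hG (hUm.mono hG') hU] at h1
  rw [h4, Pi.sub_apply, condExp_of_stronglyMeasurable (hG'.trans hG) hUm hU] at h2
  rw [abs_le] at *
  constructor <;> linarith [h1.1, h1.2, h2.1, h2.2]

lemma one_mem_upperBounds_phiDep {Ω : Type*} (G H : MeasurableSpace Ω) [MeasurableSpace Ω] (P : Measure Ω)
    [IsProbabilityMeasure P] :
    1 ∈ upperBounds {x | ∃ A B : Set Ω, MeasurableSet[G] A ∧ MeasurableSet[H] B ∧ 0 < P A ∧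
      x = |(P (A ∩ B)).toReal / (P A).toReal - (P B).toReal|} := by
  rintro _ ⟨A, B, -, -, -, rfl⟩
  have h1 : P.real (A ∩ B) / P.real A ≤ 1 :=
    div_le_one_of_le₀ (measureReal_mono Set.inter_subset_left) measureReal_nonneg
  have h2 : 0 ≤ P.real (A ∩ B) / P.real A := by positivity
  have h3 : P.real B ≤ 1 := measureReal_le_one
  have h4 : 0 ≤ P.real B := measureReal_nonneg
  exact abs_le.2 ⟨by simp only [← measureReal_def]; linarith,
    by simp only [← measureReal_def]; linarith⟩

lemma phiDep_nonneg {Ω : Type*} (G H : MeasurableSpace Ω) [MeasurableSpace Ω] (P : Measure Ω) :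
    0 ≤ phiDep P G H :=
  Real.sSup_nonneg <| by
    rintro _ ⟨A, B, -, -, -, rfl⟩
    exact abs_nonneg _

lemma phiCoef_nonneg {Ω : Type*} [MeasurableSpace Ω]
    (𝓕 : WithBot ℤ → WithTop ℤ → MeasurableSpace Ω) (P : Measure Ω) (n : ℕ) :
    0 ≤ phiCoef 𝓕 P n :=
  Real.iSup_nonneg fun _ => phiDep_nonneg _ _ _

lemma abs_measureReal_inter_sub_le {Ω : Type*} [MeasurableSpace Ω]
    (𝓕 : WithBot ℤ → WithTop ℤ → MeasurableSpace Ω) (P : Measure Ω) [IsProbabilityMeasure P]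
    (k : ℤ) (n : ℕ) {A B : Set Ω} (hA : MeasurableSet[𝓕 ⊥ (k : WithTop ℤ)] A)
    (hB : MeasurableSet[𝓕 ((k + n : ℤ) : WithBot ℤ) ⊤] B) :
    |P.real (A ∩ B) - P.real A * P.real B| ≤ phiCoef 𝓕 P n * P.real A := by
  rcases eq_or_ne (P A) 0 with h0 | h0
  · have : P (A ∩ B) = 0 := measure_mono_null Set.inter_subset_left h0
    simp [measureReal_def, h0, this]
  have hpos : 0 < P.real A := ENNReal.toReal_pos h0 (measure_ne_top _ _)
  have hle : |P.real (A ∩ B) / P.real A - P.real B| ≤ phiCoef 𝓕 P n := by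
    refine le_trans (le_csSup ⟨1, one_mem_upperBounds_phiDep _ _ P⟩
      ⟨A, B, hA, hB, pos_iff_ne_zero.2 h0, rfl⟩)
      (le_ciSup (f := fun k : ℤ => phiDep P (𝓕 ⊥ (k : WithTop ℤ))
        (𝓕 ((k + n : ℤ) : WithBot ℤ) ⊤)) ⟨1, ?_⟩ k)
    rintro _ ⟨j, rfl⟩
    exact Real.sSup_le (one_mem_upperBounds_phiDep _ _ P) zero_le_one
  calc |P.real (A ∩ B) - P.real A * P.real B|
      = |P.real (A ∩ B) / P.real A - P.real B| * P.real A := by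
        rw [← abs_of_pos hpos, ← abs_mul, abs_of_pos hpos]
        congr 1
        field_simp
    _ ≤ _ := by gcongr

lemma continuous_of_abs_sub_le_sum_rpow {ι E : Type*} [Fintype ι] [SeminormedAddCommGroup E]
    {F : (ι → E) → ℝ} {K κ : ℝ} (hκ : 0 < κ)
    (hF : ∀ x z, |F x - F z| ≤ K * ∑ i, ‖x i - z i‖ ^ κ) : Continuous F := by
  refine continuous_iff_continuousAt.2 fun z => tendsto_iff_dist_tendsto_zero.2 ?_
  have hcont : Continuous fun x : ι → E => K * ∑ i, ‖x i - z i‖ ^ κ :=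
    continuous_const.mul <| continuous_finsetSum _ fun i _ =>
      ((continuous_apply i).sub continuous_const).norm.rpow_const fun _ => Or.inr hκ.le
  refine squeeze_zero (fun _ => dist_nonneg) (fun x => hF x z) ?_
  simpa [Real.zero_rpow hκ.ne'] using hcont.tendsto z

lemma stronglyMeasurable_pi_of_forall {Ω ι E : Type*} [Finite ι] [TopologicalSpace E]
    [TopologicalSpace.PseudoMetrizableSpace E] [SecondCountableTopology E] {m : MeasurableSpace Ω}
    {f : Ω → ι → E} (hf : ∀ i, StronglyMeasurable fun ω => f ω i) :
    StronglyMeasurable f := by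
  borelize E
  exact (measurable_pi_iff.2 fun i => (hf i).measurable).stronglyMeasurable

/-- Bound on the influence, between times `m` and `m + 1`, of a term whose first entry after time
`m` has index `s`. -/
def influence (φ : ℕ → ℝ) (K : ℝ) (m r s : ℕ) : ℝ :=
  if s ≤ m then 0 else if s ≤ m + 2 * r then 2 * K else 4 * K * φ (s - (m + 1 + 2 * r))

lemma influence_nonneg {φ : ℕ → ℝ} (hφ : ∀ n, 0 ≤ φ n) {K : ℝ} (hK : 0 ≤ K) (m r s : ℕ) :
    0 ≤ influence φ K m r s := by
  unfold influence
  have := hφ (s - (m + 1 + 2 * r))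
  split_ifs <;> positivity

lemma sum_influence_le {φ : ℕ → ℝ} (hφ : ∀ n, 0 ≤ φ n) (hs : Summable φ) {K : ℝ} (hK : 0 ≤ K)
    (m r : ℕ) (t : Finset ℕ) :
    ∑ s ∈ t, influence φ K m r s ≤ 4 * K * (∑' n, φ n + r) := by
  have hshift : (fun s => influence φ K m r (s + (m + 1 + 2 * r))) = fun s => 4 * K * φ s := by
    funext s
    rw [influence, if_neg (by omega), if_neg (by omega), Nat.add_sub_cancel]
  have hsum : Summable (influence φ K m r) := by
    rw [← summable_nat_add_iff (m + 1 + 2 * r), hshift]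
    exact hs.mul_left _
  refine (hsum.sum_le_tsum t fun s _ => influence_nonneg hφ hK m r s).trans ?_
  rw [← hsum.sum_add_tsum_nat_add (m + 1 + 2 * r), hshift, tsum_mul_left, Finset.sum_range_add,
    Finset.sum_eq_zero (s := range (m + 1)) fun s hs' => by
      rw [influence, if_pos (by have := Finset.mem_range.1 hs'; omega)]]
  have : ∑ x ∈ range (2 * r), influence φ K m r (m + 1 + x) ≤ ∑ x ∈ range (2 * r), 2 * K :=
    Finset.sum_le_sum fun x hx => by
      rw [influence, if_neg (by omega), if_pos (by have := Finset.mem_range.1 hx; omega)]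
  rw [Finset.sum_const, Finset.card_range, nsmul_eq_mul] at this
  push_cast at this
  linarith

section Differences

variable {Ω E : Type*} [NormedAddCommGroup E] [SecondCountableTopology E] {ℓ : ℕ}
  {𝓕 : WithBot ℤ → WithTop ℤ → MeasurableSpace Ω}
  {η : ℕ → Ω → E} {F : (Fin ℓ → E) → ℝ} {K : ℝ} {r : ℕ}

lemma stronglyMeasurable_entries (hF : Continuous F)
    (hmono : ∀ (k k' : WithBot ℤ) (l l' : WithTop ℤ), k' ≤ k → l ≤ l' → 𝓕 k l ≤ 𝓕 k' l')
    (hη : ∀ k : ℕ, StronglyMeasurable[𝓕 (((k : ℤ) - r : ℤ) : WithBot ℤ)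
      (((k : ℤ) + r : ℤ) : WithTop ℤ)] (η k)) {n m : ℕ}
    (hm : ∀ i : Fin ℓ, (i.1 + 1) * n ≤ m) :
    StronglyMeasurable[𝓕 ⊥ (((m : ℤ) + r : ℤ) : WithTop ℤ)]
      fun ω => F fun i => η ((i.1 + 1) * n) ω := by
  refine hF.comp_stronglyMeasurable (stronglyMeasurable_pi_of_forall fun i => ?_)
  refine (hη _).mono (hmono _ _ _ _ bot_le (WithTop.coe_le_coe.2 ?_))
  have := hm i
  zify at this
  push_cast
  linarith

variable [mΩ : MeasurableSpace Ω] {P : Measure Ω} [IsProbabilityMeasure P]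

lemma abs_condExp_entries_sub_le (hF : Continuous F) (hFK : ∀ x, |F x| ≤ K) (hK : 0 ≤ K)
    (hmono : ∀ (k k' : WithBot ℤ) (l l' : WithTop ℤ), k' ≤ k → l ≤ l' → 𝓕 k l ≤ 𝓕 k' l')
    (hle : ∀ k l, 𝓕 k l ≤ mΩ)
    (hη : ∀ k : ℕ, StronglyMeasurable[𝓕 (((k : ℤ) - r : ℤ) : WithBot ℤ)
      (((k : ℤ) + r : ℤ) : WithTop ℤ)] (η k)) (n m : ℕ) :
    ∀ᵐ ω ∂P,
      |(P[fun ω => F fun i => η ((i.1 + 1) * n) ω |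
          𝓕 ⊥ ((((m + 1 : ℕ) : ℤ) + r : ℤ) : WithTop ℤ)]) ω
        - (P[fun ω => F fun i => η ((i.1 + 1) * n) ω | 𝓕 ⊥ (((m : ℤ) + r : ℤ) : WithTop ℤ)]) ω|
      ≤ ∑ i : Fin ℓ, influence (phiCoef 𝓕 P) K m r ((i.1 + 1) * n) := by
  have hnn : ∀ s, 0 ≤ influence (phiCoef 𝓕 P) K m r s :=
    influence_nonneg (phiCoef_nonneg 𝓕 P) hK m r
  have hstep : 𝓕 ⊥ (((m : ℤ) + r : ℤ) : WithTop ℤ)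
      ≤ 𝓕 ⊥ ((((m + 1 : ℕ) : ℤ) + r : ℤ) : WithTop ℤ) :=
    hmono _ _ _ _ le_rfl (WithTop.coe_le_coe.2 (by push_cast; linarith))
  set Z : Ω → ℝ := fun ω => F fun i => η ((i.1 + 1) * n) ω with hZ
  rcases (Finset.univ.filter fun i : Fin ℓ => m < (i.1 + 1) * n).eq_empty_or_nonempty with he | hne
  · have hZm : StronglyMeasurable[𝓕 ⊥ (((m : ℤ) + r : ℤ) : WithTop ℤ)] Z :=
      stronglyMeasurable_entries hF hmono hη fun i => by
        simpa using Finset.filter_eq_empty_iff.1 he (Finset.mem_univ i)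
    have hZi : Integrable Z P := .of_bound (hZm.mono (hle _ _)).aestronglyMeasurable K
      (ae_of_all _ fun ω => hFK _)
    rw [condExp_of_stronglyMeasurable (hle _ _) hZm hZi,
      condExp_of_stronglyMeasurable (hle _ _) (hZm.mono hstep) hZi]
    exact ae_of_all _ fun ω => by simpa using Finset.sum_nonneg fun i _ => hnn _
  obtain ⟨i₀, hi₀, hmin⟩ := Finset.exists_min_image _ (fun i : Fin ℓ => (i.1 + 1) * n) hne
  have hi₀m : m < (i₀.1 + 1) * n := (Finset.mem_filter.1 hi₀).2
  replace hmin : ∀ i : Fin ℓ, ¬ (i.1 + 1) * n ≤ m → (i₀.1 + 1) * n ≤ (i.1 + 1) * n :=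
    fun i hi => hmin i (Finset.mem_filter.2 ⟨Finset.mem_univ i, not_le.1 hi⟩)
  suffices hb : ∀ᵐ ω ∂P, |(P[Z | 𝓕 ⊥ ((((m + 1 : ℕ) : ℤ) + r : ℤ) : WithTop ℤ)]) ω
      - (P[Z | 𝓕 ⊥ (((m : ℤ) + r : ℤ) : WithTop ℤ)]) ω|
      ≤ influence (phiCoef 𝓕 P) K m r ((i₀.1 + 1) * n) from
    hb.mono fun ω hω => hω.trans (Finset.single_le_sum (f := fun i : Fin ℓ =>
      influence (phiCoef 𝓕 P) K m r ((i.1 + 1) * n)) (fun i _ => hnn _) (Finset.mem_univ i₀))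
  by_cases hnear : (i₀.1 + 1) * n ≤ m + 2 * r
  · rw [influence, if_neg (not_le.2 hi₀m), if_pos hnear]
    have hbd : ∀ G : MeasurableSpace Ω, ∀ᵐ ω ∂P, |(P[Z | G]) ω| ≤ K := fun G =>
      ae_bdd_abs_condExp_of_ae_bdd_abs (ae_of_all _ fun ω => hFK _)
    filter_upwards [hbd (𝓕 ⊥ ((((m + 1 : ℕ) : ℤ) + r : ℤ) : WithTop ℤ)),
      hbd (𝓕 ⊥ (((m : ℤ) + r : ℤ) : WithTop ℤ))] with ω h1 h2
    exact (abs_sub _ _).trans (by linarith)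
  rw [influence, if_neg (not_le.2 hi₀m), if_neg hnear]
  obtain ⟨g, hg⟩ := Nat.exists_eq_add_of_lt (not_le.1 hnear)
  rw [show (i₀.1 + 1) * n - (m + 1 + 2 * r) = g by omega]
  have hsplit : Z = fun ω => F fun i => if (i.1 + 1) * n ≤ m
      then (if (i.1 + 1) * n ≤ m then η ((i.1 + 1) * n) ω else 0)
      else (if (i.1 + 1) * n ≤ m then 0 else η ((i.1 + 1) * n) ω) := by
    funext ω
    simp only [hZ]
    congr 1
    funext i
    split_ifs <;> rfl
  rw [hsplit]
  refine abs_condExp_sub_condExp_le (V := Fin ℓ → E) (W := Fin ℓ → E)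
    (h := fun x y => F fun i => if (i.1 + 1) * n ≤ m then x i else y i)
    (X := fun ω i => if (i.1 + 1) * n ≤ m then η ((i.1 + 1) * n) ω else 0)
    (Y := fun ω i => if (i.1 + 1) * n ≤ m then 0 else η ((i.1 + 1) * n) ω)
    hstep (hle _ _) (hle ((((m + 1 : ℕ) : ℤ) + r + g : ℤ) : WithBot ℤ) ⊤) hK
    (fun A B hA hB => abs_measureReal_inter_sub_le 𝓕 P _ g hA hB) ?_ (fun x y => hFK _) ?_ ?_
  · refine hF.comp (continuous_pi fun i => ?_)
    split_ifs <;> fun_prop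
  · refine stronglyMeasurable_pi_of_forall fun i => ?_
    by_cases hi : (i.1 + 1) * n ≤ m
    · simp only [hi, if_true]
      refine (hη _).mono (hmono _ _ _ _ bot_le (WithTop.coe_le_coe.2 ?_))
      zify at hi
      push_cast
      linarith
    · simp only [hi, if_false]
      exact stronglyMeasurable_const
  · refine stronglyMeasurable_pi_of_forall fun i => ?_
    by_cases hi : (i.1 + 1) * n ≤ m
    · simp only [hi, if_true]
      exact stronglyMeasurable_const
    · simp only [hi, if_false]
      refine (hη _).mono (hmono _ _ _ _ (WithBot.coe_le_coe.2 ?_) le_top)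
      have := hmin i hi
      rw [hg] at this
      zify at this
      push_cast
      linarith

lemma abs_condExp_noncSum_sub_le (hF : Continuous F) (hFK : ∀ x, |F x| ≤ K) (hK : 0 ≤ K)
    (hmono : ∀ (k k' : WithBot ℤ) (l l' : WithTop ℤ), k' ≤ k → l ≤ l' → 𝓕 k l ≤ 𝓕 k' l')
    (hle : ∀ k l, 𝓕 k l ≤ mΩ) (hφ : Summable (phiCoef 𝓕 P))
    (hη : ∀ k : ℕ, StronglyMeasurable[𝓕 (((k : ℤ) - r : ℤ) : WithBot ℤ)
      (((k : ℤ) + r : ℤ) : WithTop ℤ)] (η k)) (N m : ℕ) :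
    ∀ᵐ ω ∂P,
      |(P[noncSum ℓ η F N | 𝓕 ⊥ ((((m + 1 : ℕ) : ℤ) + r : ℤ) : WithTop ℤ)]) ω
        - (P[noncSum ℓ η F N | 𝓕 ⊥ (((m : ℤ) + r : ℤ) : WithTop ℤ)]) ω|
      ≤ 4 * ℓ * K * (∑' n, phiCoef 𝓕 P n + r) := by
  have hsum : noncSum ℓ η F N
      = ∑ n ∈ Finset.Icc 1 N, fun ω => F fun i : Fin ℓ => η ((i.1 + 1) * n) ω := by
    funext ω
    simp [noncSum]
  have hint : ∀ n ∈ Finset.Icc 1 N,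
      Integrable (fun ω => F fun i : Fin ℓ => η ((i.1 + 1) * n) ω) P :=
    fun n _ => .of_bound (hF.comp_stronglyMeasurable (stronglyMeasurable_pi_of_forall fun i =>
      (hη _).mono (hle _ _))).aestronglyMeasurable K (ae_of_all _ fun ω => hFK _)
  have hterms := (ae_all_iff (μ := P)).2 fun n : ℕ =>
    abs_condExp_entries_sub_le (P := P) hF hFK hK hmono hle hη n m
  rw [hsum]
  filter_upwards [hterms, condExp_finsetSum hint _, condExp_finsetSum hint _] with ω h1 h2 h3
  rw [h2, h3, Finset.sum_apply, Finset.sum_apply, ← Finset.sum_sub_distrib]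
  refine (Finset.abs_sum_le_sum_abs _ _).trans
    ((Finset.sum_le_sum fun n _ => h1 n).trans ?_)
  rw [Finset.sum_comm]
  have hcol : ∀ i : Fin ℓ, ∑ n ∈ Finset.Icc 1 N, influence (phiCoef 𝓕 P) K m r ((i.1 + 1) * n)
      ≤ 4 * K * (∑' n, phiCoef 𝓕 P n + r) := fun i => by
    rw [← Finset.sum_image (g := fun n => (i.1 + 1) * n) (f := influence (phiCoef 𝓕 P) K m r)
      fun a _ b _ hab => Nat.eq_of_mul_eq_mul_left (Nat.succ_pos _) hab]
    exact sum_influence_le (phiCoef_nonneg 𝓕 P) hφ hK m r _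
  refine (Finset.sum_le_sum fun i _ => hcol i).trans (le_of_eq ?_)
  rw [Finset.sum_const, Finset.card_univ, Fintype.card_fin, nsmul_eq_mul]
  ring

end Differences

/-- Theorem 2.8: L∞ martingale approximation of nonconventional sums of a
bounded Hölder function. -/
theorem nonconventional_martingale_approximation (ℓ : ℕ) (hℓ : 1 ≤ ℓ) :
    ∃ B : ℝ, 0 < B ∧
      ∀ (Ω : Type) [MeasurableSpace Ω] (P : Measure Ω), IsProbabilityMeasure P →
      ∀ (p : ℕ) (K κ : ℝ) (ξ : ℕ → Ω → EuclideanSpace ℝ (Fin p))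
        (𝓕 : WithBot ℤ → WithTop ℤ → MeasurableSpace Ω)
        (F : (Fin ℓ → EuclideanSpace ℝ (Fin p)) → ℝ),
        1 ≤ K → 0 < κ → κ ≤ 1 →
        (∀ n, Measurable (ξ n)) →
        (∀ (k k' : WithBot ℤ) (l l' : WithTop ℤ), k' ≤ k → l ≤ l' → 𝓕 k l ≤ 𝓕 k' l') →
        (∀ k l, 𝓕 k l ≤ ‹MeasurableSpace Ω›) →
        (∀ n, Measure.map (ξ n) P = Measure.map (ξ 0) P) →
        (∀ x z : Fin ℓ → EuclideanSpace ℝ (Fin p),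
          |F x - F z| ≤ K * ∑ i, ‖x i - z i‖ ^ κ) →
        (∀ x, |F x| ≤ K) →
        (∫ x, F x ∂(Measure.pi fun _ : Fin ℓ => Measure.map (ξ 0) P)) = 0 →
        Summable (fun n => phiCoef 𝓕 P n) →
        ∀ N : ℕ, 1 ≤ N → ∀ r : ℕ,
          ∃ Mart : ℕ → Ω → ℝ,
            (∀ n : ℕ, 1 ≤ n →
              StronglyMeasurable[𝓕 ⊥ (((n : ℤ) + r : ℤ) : WithTop ℤ)] (Mart n)) ∧
            (∀ n : ℕ, 1 ≤ n → Integrable (Mart n) P) ∧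
            (∀ n : ℕ, 1 ≤ n →
              (P[Mart (n + 1) | 𝓕 ⊥ (((n : ℤ) + r : ℤ) : WithTop ℤ)]) =ᵐ[P] Mart n) ∧
            (∀ n : ℕ, 1 ≤ n →
              eLpNorm (fun ω => Mart (n + 1) ω - Mart n ω) ⊤ P
                ≤ ENNReal.ofReal (B * K * ((∑' n', phiCoef 𝓕 P n') + r + 1))) ∧
            eLpNorm (fun ω => noncSum ℓ ξ F N ω - Mart (ℓ * N) ω) ⊤ P
              ≤ ENNReal.ofReal (B * K * N) * betaCoef ξ 𝓕 P ⊤ r ^ κ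
                + ENNReal.ofReal (B * K * ((∑' n', phiCoef 𝓕 P n') + r + 1)) := by
  refine ⟨4 * ℓ, by positivity, ?_⟩
  intro Ω _ P _ p K κ ξ 𝓕 F hK1 hκ _ _ hmono hle _ hHol hFK _ hφ N hN r
  have hK : 0 ≤ K := zero_le_one.trans hK1
  have hF : Continuous F := continuous_of_abs_sub_le_sum_rpow hκ hHol
  set η : ℕ → Ω → EuclideanSpace ℝ (Fin p) := fun k =>
    P[ξ k | 𝓕 (((k : ℤ) - r : ℤ) : WithBot ℤ) (((k : ℤ) + r : ℤ) : WithTop ℤ)]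
  have hη : ∀ k : ℕ, StronglyMeasurable[𝓕 (((k : ℤ) - r : ℤ) : WithBot ℤ)
      (((k : ℤ) + r : ℤ) : WithTop ℤ)] (η k) := fun k => stronglyMeasurable_condExp
  have hφ0 : 0 ≤ ∑' n, phiCoef 𝓕 P n := tsum_nonneg (phiCoef_nonneg 𝓕 P)
  have hTm : StronglyMeasurable[𝓕 ⊥ ((((ℓ * N : ℕ) : ℤ) + r : ℤ) : WithTop ℤ)]
      (noncSum ℓ η F N) := by
    refine Finset.stronglyMeasurable_fun_sum _ fun n hn =>
      stronglyMeasurable_entries hF hmono hη fun i => ?_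
    exact Nat.mul_le_mul i.2 (Finset.mem_Icc.1 hn).2
  have hTi : Integrable (noncSum ℓ η F N) P := by
    refine .of_bound (hTm.mono (hle _ _)).aestronglyMeasurable (∑ n ∈ Finset.Icc 1 N, K)
      (ae_of_all _ fun ω => ?_)
    exact (norm_sum_le _ _).trans (Finset.sum_le_sum fun n _ => hFK _)
  refine ⟨fun n => P[noncSum ℓ η F N | 𝓕 ⊥ (((n : ℤ) + r : ℤ) : WithTop ℤ)],
    fun n _ => stronglyMeasurable_condExp, fun n _ => integrable_condExp, fun n _ => ?_,
    fun n _ => ?_, ?_⟩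
  · exact condExp_condExp_of_le
      (hmono _ _ _ _ le_rfl (WithTop.coe_le_coe.2 (by push_cast; linarith))) (hle _ _)
  · rw [eLpNorm_exponent_top]
    refine eLpNormEssSup_le_of_ae_bound ?_
    filter_upwards [abs_condExp_noncSum_sub_le (P := P) hF hFK hK hmono hle hφ hη N n] with ω hω
    refine hω.trans (mul_le_mul_of_nonneg_left (by linarith) (by positivity))
  · refine le_trans ?_ le_self_add
    beta_reduce
    rw [condExp_of_stronglyMeasurable (hle _ _) hTm hTi]
    have hcoef : 0 < 4 * (ℓ : ℝ) * K * N := by positivity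
    rcases eq_or_ne (betaCoef ξ 𝓕 P ⊤ r) ⊤ with htop | htop
    · rw [htop, ENNReal.top_rpow_of_pos hκ, ENNReal.mul_top (by simpa using hcoef)]
      exact le_top
    have hβ : ∀ᵐ ω ∂P, ∀ k, ‖ξ k ω - η k ω‖ ≤ (betaCoef ξ 𝓕 P ⊤ r).toReal := by
      refine ae_all_iff.2 fun k => ?_
      have hk : eLpNorm (fun ω => ξ k ω - η k ω) ⊤ P ≤ betaCoef ξ 𝓕 P ⊤ r :=
        le_iSup (fun k : ℕ => eLpNorm (fun ω => ξ k ω - η k ω) ⊤ P) k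
      rw [eLpNorm_exponent_top] at hk
      filter_upwards [enorm_ae_le_eLpNormEssSup (fun ω => ξ k ω - η k ω) P] with ω hω
      simpa using ENNReal.toReal_mono htop (hω.trans hk)
    set b := (betaCoef ξ 𝓕 P ⊤ r).toReal
    have hb : ENNReal.ofReal (4 * ℓ * K * N) * betaCoef ξ 𝓕 P ⊤ r ^ κ
        = ENNReal.ofReal (4 * ℓ * K * N * b ^ κ) := by
      rw [ENNReal.ofReal_mul hcoef.le, ← ENNReal.ofReal_rpow_of_nonneg ENNReal.toReal_nonneg hκ.le,
        ENNReal.ofReal_toReal htop]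
    rw [hb, eLpNorm_exponent_top]
    refine eLpNormEssSup_le_of_ae_bound ?_
    filter_upwards [hβ] with ω hω
    have hterm : ∀ n, |F (fun i => ξ ((i.1 + 1) * n) ω) - F (fun i => η ((i.1 + 1) * n) ω)|
        ≤ K * (ℓ * b ^ κ) := fun n => by
      refine (hHol _ _).trans (mul_le_mul_of_nonneg_left ?_ hK)
      refine (Finset.sum_le_sum fun i _ =>
        Real.rpow_le_rpow (norm_nonneg _) (hω ((i.1 + 1) * n)) hκ.le).trans (le_of_eq ?_)
      simp
    rw [noncSum, noncSum, ← Finset.sum_sub_distrib]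
    refine (norm_sum_le _ _).trans ((Finset.sum_le_sum fun n _ => hterm n).trans ?_)
    rw [Finset.sum_const, Nat.card_Icc, nsmul_eq_mul, Nat.add_sub_cancel]
    have : 0 ≤ ℓ * K * N * b ^ κ := by positivity
    linarith
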